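/- Let X be a compact metric space and f : X → X a continuous map. If the map ω_f : X → 2^X, x ↦ ω_f(x), is continuous (with respect to the Hausdorff metric on nonempty closed subsets of X), then for every x ∈ X and every negative trajectory ⟨x_{-n}⟩_{n≥0} through x, the set ω_f(x) is the unique minimal set of f contained in the α-limit set α(⟨x_{-n}⟩, f) of this trajectory. -/

import Mathlib

open Set Filter Metric Topology

/-- The defining condition of a regular curve: every point has arbitrarily small
open neighborhoods with finite boundary. (Together with the instance assumptions
`Nonempty`, `CompactSpace`, `ConnectedSpace` on a metric space, this says `X` is a
regular curve.) -/
def regularCurveAx (X : Type*) [MetricSpace X] : Prop :=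
  ∀ (x : X) (V : Set X), IsOpen V → x ∈ V →
    ∃ U : Set X, IsOpen U ∧ x ∈ U ∧ U ⊆ V ∧ (frontier U).Finite

/-- The ω-limit set of `x` under `f`: all limits of `f^[n i] x` along a strictly
increasing sequence of integers `n`. -/
def omegaSet {X : Type*} [MetricSpace X] (f : X → X) (x : X) : Set X :=
  {y | ∃ n : ℕ → ℕ, StrictMono n ∧ Tendsto (fun i => f^[n i] x) atTop (𝓝 y)}

/-- `M` is a minimal set of `f`: nonempty, closed, strongly invariant, and without
any proper nonempty closed strongly invariant subset. -/
def IsMinimalSet {X : Type*} [MetricSpace X] (f : X → X) (M : Set X) : Prop :=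
  M.Nonempty ∧ IsClosed M ∧ f '' M = M ∧
    ∀ N : Set X, N ⊆ M → N.Nonempty → IsClosed N → f '' N = N → N = M

/-- The α-limit set of a negative trajectory: the set of all limit points of the
sequence. -/
def alphaTraj {X : Type*} [MetricSpace X] (s : ℕ → X) : Set X :=
  {y | ∃ n : ℕ → ℕ, StrictMono n ∧ Tendsto (fun i => s (n i)) atTop (𝓝 y)}

theorem setOf_strictMono_tendsto_eq {X : Type*} [MetricSpace X] (u : ℕ → X) :
    {y | ∃ n : ℕ → ℕ, StrictMono n ∧ Tendsto (fun i => u (n i)) atTop (𝓝 y)} =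
      {y | MapClusterPt y atTop u} := by
  ext y
  constructor
  · rintro ⟨n, hn, h⟩
    exact MapClusterPt.of_comp hn.tendsto_atTop h.mapClusterPt
  · intro h
    exact h.tendsto_subseq

theorem mapClusterPt_add_iff {X : Type*} [TopologicalSpace X] (u : ℕ → X) (k : ℕ) (y : X) :
    MapClusterPt y atTop (fun n => u (n + k)) ↔ MapClusterPt y atTop u := by
  have h := mapClusterPt_comp (F := atTop) (φ := fun n : ℕ => n + k) (u := u) (x := y)
  rw [map_add_atTop_eq_nat] at h
  exact h

theorem iterate_negative_trajectory {X : Type*} {f : X → X} {s : ℕ → X} (hs : ∀ n, f (s (n + 1)) = s n)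
    (n : ℕ) : f^[n] (s n) = s 0 := by
  induction n with
  | zero => rfl
  | succ n ih => rw [Function.iterate_succ_apply, hs, ih]

section

variable {X : Type*} [MetricSpace X] {f : X → X}

theorem mem_omegaSet_iff {x y : X} :
    y ∈ omegaSet f x ↔ MapClusterPt y atTop (fun n => f^[n] x) :=
  Set.ext_iff.1 (setOf_strictMono_tendsto_eq fun n => f^[n] x) y

theorem mem_alphaTraj_iff {s : ℕ → X} {y : X} :
    y ∈ alphaTraj s ↔ MapClusterPt y atTop s :=
  Set.ext_iff.1 (setOf_strictMono_tendsto_eq s) y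

theorem isClosed_omegaSet (x : X) : IsClosed (omegaSet f x) := by
  have h : omegaSet f x = {y | MapClusterPt y atTop (fun n => f^[n] x)} :=
    Set.ext fun _ => mem_omegaSet_iff
  rw [h]
  exact isClosed_setOfPred_clusterPt

theorem isClosed_alphaTraj (s : ℕ → X) : IsClosed (alphaTraj s) := by
  have h : alphaTraj s = {y | MapClusterPt y atTop s} := Set.ext fun _ => mem_alphaTraj_iff
  rw [h]
  exact isClosed_setOfPred_clusterPt

theorem omegaSet_nonempty [CompactSpace X] (x : X) : (omegaSet f x).Nonempty := by
  obtain ⟨y, n, hn, h⟩ := CompactSpace.tendsto_subseq (fun n => f^[n] x)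
  exact ⟨y, n, hn, h⟩

theorem alphaTraj_nonempty [CompactSpace X] (s : ℕ → X) : (alphaTraj s).Nonempty := by
  obtain ⟨y, n, hn, h⟩ := CompactSpace.tendsto_subseq s
  exact ⟨y, n, hn, h⟩

theorem omegaSet_iterate (k : ℕ) (x : X) : omegaSet f (f^[k] x) = omegaSet f x := by
  ext y
  simp only [mem_omegaSet_iff, ← Function.iterate_add_apply]
  exact mapClusterPt_add_iff (fun n => f^[n] x) k y

theorem omegaSet_subset_of_mapsTo {N : Set X} (hN : IsClosed N) (h : MapsTo f N N) {x : X}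
    (hx : x ∈ N) : omegaSet f x ⊆ N := by
  rintro y ⟨n, -, hy⟩
  exact hN.mem_of_tendsto hy (Eventually.of_forall fun i => h.iterate (n i) hx)

theorem image_omegaSet [CompactSpace X] (hf : Continuous f) (x : X) :
    f '' omegaSet f x = omegaSet f x := by
  apply Subset.antisymm
  · rintro _ ⟨y, ⟨n, hn, hy⟩, rfl⟩
    refine ⟨fun i => n i + 1, fun i j hij => Nat.succ_lt_succ (hn hij), ?_⟩
    simpa only [Function.iterate_succ_apply', Function.comp_def] using (hf.tendsto y).comp hy
  · rintro y ⟨n, hn, hy⟩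
    obtain ⟨z, φ, hφ, hz⟩ := CompactSpace.tendsto_subseq (fun i => f^[n i - 1] x)
    have hnφ : Tendsto (fun i => n (φ i)) atTop atTop := (hn.comp hφ).tendsto_atTop
    refine ⟨z, mem_omegaSet_iff.2 (MapClusterPt.of_comp
      ((tendsto_sub_atTop_nat 1).comp hnφ) hz.mapClusterPt), ?_⟩
    refine tendsto_nhds_unique ((hf.tendsto z).comp hz)
      ((hy.comp hφ.tendsto_atTop).congr' ?_)
    filter_upwards [hnφ.eventually_ge_atTop 1] with i hi
    simp only [Function.comp_apply]
    rw [← Function.iterate_succ_apply' f, Nat.succ_eq_add_one, Nat.sub_add_cancel hi]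

theorem mapsTo_alphaTraj (hf : Continuous f) {s : ℕ → X} (hs : ∀ n, f (s (n + 1)) = s n) :
    MapsTo f (alphaTraj s) (alphaTraj s) := by
  intro y hy
  rw [mem_alphaTraj_iff] at hy ⊢
  have h := (mapClusterPt_add_iff (f ∘ s) 1 (f y)).2 (hy.continuousAt_comp hf.continuousAt)
  simpa only [Function.comp_apply, hs] using h

/-- If `ω_f` is continuous and takes a constant value along a convergent sequence, it takes the same
value at the limit of the sequence. -/
theorem omegaSet_eq_of_tendsto [CompactSpace X]
    (hcont : ∀ x : X, ∀ ε > 0, ∃ δ > 0, ∀ y : X, dist y x < δ →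
      hausdorffDist (omegaSet f y) (omegaSet f x) < ε)
    {u : ℕ → X} {x y : X} (hu : ∀ i, omegaSet f (u i) = omegaSet f x)
    (hy : Tendsto u atTop (𝓝 y)) : omegaSet f y = omegaSet f x := by
  have hfin : hausdorffEDist (omegaSet f x) (omegaSet f y) ≠ ⊤ :=
    hausdorffEDist_ne_top_of_nonempty_of_bounded (omegaSet_nonempty x) (omegaSet_nonempty y)
      (isClosed_omegaSet x).isCompact.isBounded (isClosed_omegaSet y).isCompact.isBounded
  refine (((isClosed_omegaSet x).hausdorffDist_zero_iff_eq (isClosed_omegaSet y) hfin).1 ?_).symm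
  refine le_antisymm (le_of_forall_pos_le_add fun ε hε => ?_) hausdorffDist_nonneg
  obtain ⟨δ, hδ, h⟩ := hcont y ε hε
  obtain ⟨i, hi⟩ := (hy.eventually (ball_mem_nhds y hδ)).exists
  rw [zero_add, ← hu i]
  exact (h (u i) hi).le

end

/-- If x ↦ ω_f(x) is continuous, then for every negative trajectory through x,
ω_f(x) is the unique minimal set contained in the α-limit set of the trajectory. -/
theorem omegaSet_unique_minimal_in_alphaTraj {X : Type*} [MetricSpace X]
    [CompactSpace X] (f : X → X) (hf : Continuous f)
    (hcont : ∀ x : X, ∀ ε > 0, ∃ δ > 0, ∀ y : X, dist y x < δ →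
      hausdorffDist (omegaSet f y) (omegaSet f x) < ε)
    (x : X) (s : ℕ → X) (hs0 : s 0 = x) (hs : ∀ n : ℕ, f (s (n + 1)) = s n) :
    IsMinimalSet f (omegaSet f x) ∧ omegaSet f x ⊆ alphaTraj s ∧
      ∀ N : Set X, N ⊆ alphaTraj s → IsMinimalSet f N → N = omegaSet f x := by
  have hω : ∀ y ∈ omegaSet f x, omegaSet f y = omegaSet f x := by
    rintro y ⟨n, -, hy⟩
    exact omegaSet_eq_of_tendsto hcont (fun i => omegaSet_iterate (n i) x) hy
  have hsω : ∀ n, omegaSet f (s n) = omegaSet f x := fun n => by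
    rw [← omegaSet_iterate n (s n), iterate_negative_trajectory hs, hs0]
  have hα : ∀ y ∈ alphaTraj s, omegaSet f y = omegaSet f x := by
    rintro y ⟨n, -, hy⟩
    exact omegaSet_eq_of_tendsto hcont (fun i => hsω (n i)) hy
  refine ⟨⟨omegaSet_nonempty x, isClosed_omegaSet x, image_omegaSet hf x, ?_⟩, ?_, ?_⟩
  · rintro N hN ⟨y, hy⟩ hNc hNf
    refine hN.antisymm ?_
    rw [← hω y (hN hy)]
    exact omegaSet_subset_of_mapsTo hNc (mapsTo_iff_image_subset.2 hNf.subset) hy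
  · obtain ⟨y, hy⟩ := alphaTraj_nonempty s
    rw [← hα y hy]
    exact omegaSet_subset_of_mapsTo (isClosed_alphaTraj s) (mapsTo_alphaTraj hf hs) hy
  · rintro N hN ⟨⟨y, hy⟩, hNc, hNf, hmin⟩
    refine (hmin _ ?_ (omegaSet_nonempty x) (isClosed_omegaSet x) (image_omegaSet hf x)).symm
    rw [← hα y (hN hy)]
    exact omegaSet_subset_of_mapsTo hNc (mapsTo_iff_image_subset.2 hNf.subset) hy
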